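/- Let ζ > 0 and let S_ζ be the bounded operator on L²((0,ζ);ℂ) given by (S_ζ f)(x) = f(x) - ∫₀^ζ k(x-y) f(y) dy, and let Q be the bounded multiplication operator (Qf)(x) = x·f(x) on L²((0,ζ);ℂ). Then for every f ∈ L²((0,ζ);ℂ) and almost every x ∈ (0,ζ): (Q S_ζ f - S_ζ Q f)(x) = -(1/(2πi)) ∫₀^ζ (e^{iπ(x-y)} - e^{-iπ(x-y)}) f(y) dy. -/

import Mathlib

open MeasureTheory Set Filter
open scoped Real

/-- The sine kernel `k(x) = sin(πx)/(πx)` with `k(0) = 1`. -/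
noncomputable def sineKernel (x : ℝ) : ℝ :=
  if x = 0 then 1 else Real.sin (π * x) / (π * x)

theorem sineKernel_eq_sinc (x : ℝ) : sineKernel x = Real.sinc (π * x) := by
  by_cases hx : x = 0
  · simp [sineKernel, hx]
  · rw [sineKernel, if_neg hx, Real.sinc_of_ne_zero (mul_ne_zero Real.pi_ne_zero hx)]

theorem continuous_sineKernel : Continuous sineKernel := by
  rw [funext sineKernel_eq_sinc]
  exact Real.continuous_sinc.comp (continuous_const.mul continuous_id)

theorem abs_sineKernel_le_one (x : ℝ) : |sineKernel x| ≤ 1 := by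
  rw [sineKernel_eq_sinc]
  exact Real.abs_sinc_le_one _

/-- Multiplying the sine kernel by its argument leaves a difference of exponentials. -/
theorem mul_sineKernel_eq_exp (x : ℝ) :
    (x : ℂ) * (sineKernel x : ℂ) = 1 / (2 * (π : ℂ) * Complex.I) *
      (Complex.exp (Complex.I * π * x) - Complex.exp (-(Complex.I * π * x))) := by
  have hπ : (π : ℂ) ≠ 0 := Complex.ofReal_ne_zero.mpr Real.pi_ne_zero
  by_cases hx : x = 0
  · simp [hx]
  have hx' : (x : ℂ) ≠ 0 := Complex.ofReal_ne_zero.mpr hx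
  have hsin : Complex.exp (Complex.I * π * x) - Complex.exp (-(Complex.I * π * x)) =
      2 * Complex.I * Complex.sin (π * x) := by
    rw [Complex.sin, show Complex.I * π * x = π * x * Complex.I by ring, neg_mul]
    linear_combination -(Complex.exp (-(π * x * Complex.I)) -
      Complex.exp (π * x * Complex.I)) * Complex.I_sq
  rw [hsin, sineKernel, if_neg hx]
  push_cast
  field_simp [Complex.I_ne_zero]

/-- Convolution against the sine kernel is integrable for an integrable function. -/
theorem MeasureTheory.Integrable.sineKernel_mul {μ : Measure ℝ} {f : ℝ → ℂ}
    (hf : Integrable f μ) (x : ℝ) :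
    Integrable (fun y => (sineKernel (x - y) : ℂ) * f y) μ := by
  refine hf.bdd_mul (c := 1) ?_ (ae_of_all _ fun y => ?_)
  · exact (Complex.continuous_ofReal.comp
      (continuous_sineKernel.comp (continuous_const.sub continuous_id))).aestronglyMeasurable
  · simpa using abs_sineKernel_le_one (x - y)

/-- the operator identity `Q S_ζ - S_ζ Q` for the truncated sine-kernel
operator `S_ζ` and the multiplication operator `Q` on `L²((0,ζ);ℂ)`. -/
theorem sine_kernel_operator_identity_Q (ζ : ℝ) (hζ : 0 < ζ)
    (S Q : Lp ℂ 2 (volume.restrict (Ioo (0:ℝ) ζ)) →L[ℂ] Lp ℂ 2 (volume.restrict (Ioo (0:ℝ) ζ)))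
    (hS : ∀ f : Lp ℂ 2 (volume.restrict (Ioo (0:ℝ) ζ)),
      ∀ᵐ x ∂(volume.restrict (Ioo (0:ℝ) ζ)),
        S f x = f x - ∫ y in Ioo (0:ℝ) ζ, (sineKernel (x - y) : ℂ) * f y)
    (hQ : ∀ f : Lp ℂ 2 (volume.restrict (Ioo (0:ℝ) ζ)),
      ∀ᵐ x ∂(volume.restrict (Ioo (0:ℝ) ζ)), Q f x = (x : ℂ) * f x) :
    ∀ f : Lp ℂ 2 (volume.restrict (Ioo (0:ℝ) ζ)),
      ∀ᵐ x ∂(volume.restrict (Ioo (0:ℝ) ζ)),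
        Q (S f) x - S (Q f) x
          = -(1 / (2 * (π : ℂ) * Complex.I)) *
              ∫ y in Ioo (0:ℝ) ζ,
                (Complex.exp (Complex.I * π * ((x : ℂ) - (y : ℂ)))
                  - Complex.exp (-(Complex.I * π * ((x : ℂ) - (y : ℂ))))) * f y := by
  intro f
  have hf : Integrable f (volume.restrict (Ioo (0:ℝ) ζ)) :=
    (Lp.memLp f).integrable one_le_two
  have hQf : Integrable (fun y : ℝ => (y : ℂ) * f y) (volume.restrict (Ioo (0:ℝ) ζ)) :=
    ((Lp.memLp (Q f)).integrable one_le_two).congr (hQ f)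
  filter_upwards [hQ (S f), hS f, hS (Q f), hQ f] with x hQS hSf hSQ hQx
  have hcongr : ∫ y in Ioo (0:ℝ) ζ, (sineKernel (x - y) : ℂ) * Q f y =
      ∫ y in Ioo (0:ℝ) ζ, (sineKernel (x - y) : ℂ) * ((y : ℂ) * f y) :=
    integral_congr_ae ((hQ f).mono fun y hy => by simp only [hy])
  rw [hQS, hSf, hSQ, hQx, hcongr, mul_sub, sub_sub_sub_cancel_left, neg_mul,
    ← integral_const_mul, ← integral_const_mul,
    ← integral_sub (hQf.sineKernel_mul x) ((hf.sineKernel_mul x).const_mul (x : ℂ)), ← integral_neg]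
  refine integral_congr_ae (ae_of_all _ fun y => ?_)
  dsimp only
  have h := mul_sineKernel_eq_exp (x - y)
  push_cast at h
  linear_combination -(f y) * h
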